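/- Fix $n \ge 3$ and $a \in (0,1)$, and let $\mathrm{w}_a \in \{0, a, 1\}^n$ be a vector that has at least one entry equal to $a$. Then there exist $d_0 > 0$ and $\varepsilon > 0$ such that for every $d \in (0, d_0)$ there is a unique solution $\mathrm{u}(d)$ of the cyclic system $d(\mathrm{u}_{i-1} - 2\mathrm{u}_i + \mathrm{u}_{i+1}) + g(\mathrm{u}_i;a) = 0$ (indices mod $n$) in the $\varepsilon$-ball around $\mathrm{w}_a$, and the Jacobian matrix $D_1 G(\mathrm{u}(d); a, d)$ has an eigenvalue with positive real part; consequently $\mathrm{u}(d)$ is not an asymptotically stable equilibrium of $\dot{\mathrm{u}} = G(\mathrm{u};a,d)$. -/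

import Mathlib

open Filter

/-- The cubic bistable nonlinearity `g(u; a) = u(1-u)(u-a)`. -/
noncomputable def g (a u : ℝ) : ℝ := u * (1 - u) * (u - a)

/-- The derivative `g'(u; a)` of the cubic nonlinearity with respect to `u`. -/
noncomputable def gder (a u : ℝ) : ℝ := (1 - u) * (u - a) - u * (u - a) + u * (1 - u)

/-- The right-hand side of the Nagumo equation on the cycle graph `C_n`. -/
noncomputable def GF (n : ℕ) (a d : ℝ) (v : ZMod n → ℝ) : ZMod n → ℝ :=
  fun i => d * (v (i - 1) - 2 * v i + v (i + 1)) + g a (v i)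

/-- The Jacobian matrix `D₁G(v; a, d)` of the cyclic Nagumo system with respect to `v`. -/
noncomputable def Jac (n : ℕ) (a d : ℝ) (v : ZMod n → ℝ) : Matrix (ZMod n) (ZMod n) ℝ :=
  fun i j => (if j = i - 1 then d else 0) + (if j = i + 1 then d else 0) +
    (if j = i then -(2 * d) + gder a (v i) else 0)

/-- A solution (for `t ≥ 0`) of the graph Nagumo ODE `u' = G(u; a, d)` on `ℝⁿ`. -/
def IsODESol (n : ℕ) [NeZero n] (a d : ℝ) (V : ℝ → ZMod n → ℝ) : Prop :=
  ∀ t : ℝ, 0 ≤ t → HasDerivAt V (GF n a d (V t)) t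

/-- Asymptotic stability of an equilibrium `p` of the graph Nagumo ODE on `ℝⁿ`. -/
def ODEAsympStable (n : ℕ) [NeZero n] (a d : ℝ) (p : ZMod n → ℝ) : Prop :=
  (∀ ε > 0, ∃ δ > 0, ∀ V : ℝ → ZMod n → ℝ, IsODESol n a d V → ‖V 0 - p‖ < δ →
      ∀ t : ℝ, 0 ≤ t → ‖V t - p‖ < ε) ∧
  ∃ δ > 0, ∀ V : ℝ → ZMod n → ℝ, IsODESol n a d V → ‖V 0 - p‖ < δ →
      Tendsto V atTop (nhds p)

/-! ### Global solutions of bounded Lipschitz vector fields -/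

/-- A bounded, globally Lipschitz autonomous vector field has a global integral curve through
every point. -/
theorem exists_global_solution_of_lipschitzWith_of_bounded {E : Type*} [NormedAddCommGroup E]
    [NormedSpace ℝ E] [CompleteSpace E] {f : E → E} {K L : NNReal} (hK : LipschitzWith K f)
    (hL : ∀ x, ‖f x‖ ≤ L) (x : E) :
    ∃ V : ℝ → E, V 0 = x ∧ ∀ t, HasDerivAt V (f (V t)) t := by
  have hloc : ∀ m : ℕ, ∃ α : ℝ → E, α 0 = x ∧
      ∀ t ∈ Set.Ioo (-((m : ℝ) + 1)) ((m : ℝ) + 1), HasDerivAt α (f (α t)) t := by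
    intro m
    have hm : (0 : ℝ) ≤ (m : ℝ) + 1 := by positivity
    have hP : IsPicardLindelof (fun _ : ℝ => f)
        (⟨0, by linarith, hm⟩ : Set.Icc (-((m : ℝ) + 1)) ((m : ℝ) + 1)) x
        (L * (m + 1)) 0 L K :=
      .of_time_independent (fun y _ => hL y) hK.lipschitzOnWith (by simp)
    obtain ⟨α, h0, hα⟩ := hP.exists_eq_forall_mem_Icc_hasDerivWithinAt₀
    exact ⟨α, h0, fun t ht =>
      (hα t (Set.Ioo_subset_Icc_self ht)).hasDerivAt (Icc_mem_nhds ht.1 ht.2)⟩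
  choose α h0 hα using hloc
  have hmono : ∀ m k : ℕ, m ≤ k →
      Set.EqOn (α m) (α k) (Set.Ioo (-((m : ℝ) + 1)) ((m : ℝ) + 1)) := by
    intro m k hmk
    have hmk' : (m : ℝ) ≤ k := by exact_mod_cast hmk
    have hm : (0 : ℝ) ≤ m := m.cast_nonneg
    refine ODE_solution_unique_of_mem_Ioo (v := fun _ => f) (s := fun _ => Set.univ) (t₀ := 0)
      (fun _ _ => hK.lipschitzOnWith) ⟨by linarith, by linarith⟩
      (fun t ht => ⟨hα m t ht, trivial⟩)
      (fun t ht => ⟨hα k t ⟨by linarith [ht.1], by linarith [ht.2]⟩, trivial⟩) ?_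
    rw [h0, h0]
  have hglue : ∀ (m : ℕ) (s : ℝ), s ∈ Set.Ioo (-((m : ℝ) + 1)) ((m : ℝ) + 1) →
      α ⌈|s|⌉₊ s = α m s := by
    intro m s hs
    have hs' : s ∈ Set.Ioo (-((⌈|s|⌉₊ : ℝ) + 1)) ((⌈|s|⌉₊ : ℝ) + 1) := by
      have := Nat.le_ceil |s|
      constructor <;> linarith [neg_abs_le s, le_abs_self s]
    rcases le_total ⌈|s|⌉₊ m with h | h
    · exact hmono _ _ h hs'
    · exact (hmono _ _ h hs).symm
  refine ⟨fun t => α ⌈|t|⌉₊ t, by simp [h0], fun t => ?_⟩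
  have ht : t ∈ Set.Ioo (-((⌈|t|⌉₊ : ℝ) + 1)) ((⌈|t|⌉₊ : ℝ) + 1) := by
    have := Nat.le_ceil |t|
    constructor <;> linarith [neg_abs_le t, le_abs_self t]
  refine (hα _ t ht).congr_of_eventuallyEq ?_
  filter_upwards [Ioo_mem_nhds ht.1 ht.2] with s hs
  exact hglue _ s hs

/-! ### Estimates for the cubic -/

/-- The divided difference of `g` is Lipschitz-close to the derivative at a point of `[0, 1]`. -/
theorem abs_g_sub_g_sub_gder_mul_le {a w r x y : ℝ} (ha : a ∈ Set.Icc (0 : ℝ) 1)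
    (hw : w ∈ Set.Icc (0 : ℝ) 1) (hr : r ≤ 1) (hx : |x - w| ≤ r) (hy : |y - w| ≤ r) :
    |g a x - g a y - gder a w * (x - y)| ≤ 9 * r * |x - y| := by
  have hr0 : 0 ≤ r := (abs_nonneg _).trans hx
  have hfac : g a x - g a y - gder a w * (x - y) =
      ((1 + a - 3 * w) * ((x - w) + (y - w))
        - ((x - w) ^ 2 + (x - w) * (y - w) + (y - w) ^ 2)) * (x - y) := by
    simp only [g, gder]; ring
  rw [hfac, abs_mul]
  gcongr
  obtain ⟨ha0, ha1⟩ := ha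
  obtain ⟨hw0, hw1⟩ := hw
  have hc : |1 + a - 3 * w| ≤ 3 := by rw [abs_le]; constructor <;> linarith
  have hxy : |(x - w) + (y - w)| ≤ 2 * r := (abs_add_le _ _).trans (by linarith)
  have hlin : |(1 + a - 3 * w) * ((x - w) + (y - w))| ≤ 3 * (2 * r) := by
    rw [abs_mul]; gcongr
  have hxx : |(x - w) ^ 2| ≤ r := by
    rw [abs_pow]; nlinarith [abs_nonneg (x - w)]
  have hyy : |(y - w) ^ 2| ≤ r := by
    rw [abs_pow]; nlinarith [abs_nonneg (y - w)]
  have hxy' : |(x - w) * (y - w)| ≤ r := by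
    rw [abs_mul]; nlinarith [abs_nonneg (x - w), abs_nonneg (y - w)]
  rw [abs_le] at *
  constructor <;> linarith [hlin.1, hlin.2, hxx.1, hxx.2, hyy.1, hyy.2, hxy'.1, hxy'.2]

/-- Lipschitz estimate for the derivative of `g` at a point of `[0, 1]`. -/
theorem abs_gder_sub_gder_le {a w r x : ℝ} (ha : a ∈ Set.Icc (0 : ℝ) 1)
    (hw : w ∈ Set.Icc (0 : ℝ) 1) (hr : r ≤ 1) (hx : |x - w| ≤ r) :
    |gder a x - gder a w| ≤ 9 * r := by
  have hfac : gder a x - gder a w = 2 * (1 + a - 3 * w) * (x - w) - 3 * (x - w) ^ 2 := by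
    simp only [gder]; ring
  have hr0 : 0 ≤ r := (abs_nonneg _).trans hx
  obtain ⟨ha0, ha1⟩ := ha
  obtain ⟨hw0, hw1⟩ := hw
  have hc : |2 * (1 + a - 3 * w)| ≤ 6 := by rw [abs_le]; constructor <;> linarith
  have hlin : |2 * (1 + a - 3 * w) * (x - w)| ≤ 6 * r := by
    rw [abs_mul]; gcongr
  have hxx : |(x - w) ^ 2| ≤ r := by
    rw [abs_pow]; nlinarith [abs_nonneg (x - w)]
  rw [hfac]
  rw [abs_le] at *
  constructor <;> linarith [hlin.1, hlin.2, hxx.1, hxx.2]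

/-- At the roots `0`, `a`, `1` of the cubic, its derivative is bounded away from zero. -/
theorem le_abs_gder_of_root {a w : ℝ} (ha : a ∈ Set.Ioo (0 : ℝ) 1)
    (hw : w = 0 ∨ w = a ∨ w = 1) : a * (1 - a) ≤ |gder a w| := by
  obtain ⟨h0, h1⟩ := ha
  rcases hw with rfl | rfl | rfl
  · refine le_trans ?_ (neg_le_abs _)
    simp only [gder]; nlinarith
  · refine le_trans ?_ (le_abs_self _)
    simp only [gder]; nlinarith
  · refine le_trans ?_ (neg_le_abs _)
    simp only [gder]; nlinarith

/-- The cubic vanishes at `0`, `a` and `1`. -/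
theorem g_eq_zero_of_root {a w : ℝ} (hw : w = 0 ∨ w = a ∨ w = 1) : g a w = 0 := by
  rcases hw with rfl | rfl | rfl <;> simp [g]

/-! ### Existence and uniqueness of the stationary solution -/

/-- The discrete Laplacian on the cycle has norm at most `4` for the supremum norm. -/
theorem abs_laplacian_le {n : ℕ} [NeZero n] (x : ZMod n → ℝ) (i : ZMod n) :
    |x (i - 1) - 2 * x i + x (i + 1)| ≤ 4 * ‖x‖ := by
  have h := fun j => abs_le.1 ((Real.norm_eq_abs _).symm.le.trans (norm_le_pi_norm x j))
  rw [abs_le]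
  constructor <;> linarith [(h (i - 1)).1, (h (i - 1)).2, (h i).1, (h i).2, (h (i + 1)).1,
    (h (i + 1)).2]

/-- The simplified Newton map for `GF`, with the derivative frozen at `w` and `d = 0`. -/
noncomputable def newtonMap (n : ℕ) (a d : ℝ) (w v : ZMod n → ℝ) : ZMod n → ℝ :=
  fun i => v i - GF n a d v i / gder a (w i)

theorem newtonMap_eq_self_iff {n : ℕ} {a d : ℝ} {w v : ZMod n → ℝ}
    (hw : ∀ i, gder a (w i) ≠ 0) :
    newtonMap n a d w v = v ↔ ∀ i, GF n a d v i = 0 := by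
  simp [funext_iff, newtonMap, hw]

/-- The simplified Newton map is Lipschitz on a ball around `w`. -/
theorem norm_newtonMap_sub_le {n : ℕ} [NeZero n] {a d r m : ℝ} {w x y : ZMod n → ℝ}
    (ha : a ∈ Set.Icc (0 : ℝ) 1) (hw : ∀ i, w i ∈ Set.Icc (0 : ℝ) 1) (hm : 0 < m)
    (hwm : ∀ i, m ≤ |gder a (w i)|) (hd : 0 ≤ d) (hr : r ≤ 1)
    (hx : ‖x - w‖ ≤ r) (hy : ‖y - w‖ ≤ r) :
    ‖newtonMap n a d w x - newtonMap n a d w y‖ ≤ (9 * r + 4 * d) / m * ‖x - y‖ := by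
  have hr0 : 0 ≤ r := (norm_nonneg _).trans hx
  refine (pi_norm_le_iff_of_nonneg (by positivity)).2 fun i => ?_
  have hl : 0 < |gder a (w i)| := hm.trans_le (hwm i)
  have hne : gder a (w i) ≠ 0 := abs_pos.1 hl
  have hxi : |x i - w i| ≤ r := (norm_le_pi_norm (x - w) i).trans hx
  have hyi : |y i - w i| ≤ r := (norm_le_pi_norm (y - w) i).trans hy
  have hxyi : |x i - y i| ≤ ‖x - y‖ := norm_le_pi_norm (x - y) i
  have hg := abs_g_sub_g_sub_gder_mul_le ha (hw i) hr hxi hyi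
  have hlap := abs_laplacian_le (x - y) i
  have heq : (newtonMap n a d w x - newtonMap n a d w y) i =
      -((g a (x i) - g a (y i) - gder a (w i) * (x i - y i)) +
        d * ((x - y) (i - 1) - 2 * (x - y) i + (x - y) (i + 1))) / gder a (w i) := by
    simp only [newtonMap, GF, Pi.sub_apply]
    field_simp
    ring
  rw [heq, Real.norm_eq_abs, abs_div, abs_neg, div_mul_eq_mul_div]
  gcongr ?_ / ?_
  · refine (abs_add_le _ _).trans ?_
    rw [abs_mul d, abs_of_nonneg hd, add_mul]
    have h1 : 9 * r * |x i - y i| ≤ 9 * r * ‖x - y‖ := by gcongr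
    have h2 := mul_le_mul_of_nonneg_left hlap hd
    linarith
  · exact hwm i

/-- The displacement of `w` under the simplified Newton map. -/
theorem norm_newtonMap_self_sub_le {n : ℕ} [NeZero n] {a d m : ℝ} {w : ZMod n → ℝ}
    (hw : ∀ i, w i ∈ Set.Icc (0 : ℝ) 1) (hg : ∀ i, g a (w i) = 0) (hm : 0 < m)
    (hwm : ∀ i, m ≤ |gder a (w i)|) (hd : 0 ≤ d) :
    ‖newtonMap n a d w w - w‖ ≤ 4 * d / m := by
  refine (pi_norm_le_iff_of_nonneg (by positivity)).2 fun i => ?_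
  have hw1 : ‖w‖ ≤ 1 := (pi_norm_le_iff_of_nonneg zero_le_one).2 fun j => by
    rw [Real.norm_eq_abs, abs_of_nonneg (hw j).1]; exact (hw j).2
  have hlap : |w (i - 1) - 2 * w i + w (i + 1)| ≤ 4 := by
    linarith [abs_laplacian_le w i]
  have heq : (newtonMap n a d w w - w) i =
      -(d * (w (i - 1) - 2 * w i + w (i + 1))) / gder a (w i) := by
    simp only [newtonMap, GF, Pi.sub_apply, hg i]
    ring
  rw [heq, Real.norm_eq_abs, abs_div, abs_neg, abs_mul, abs_of_nonneg hd, mul_comm 4 d]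
  gcongr
  exact hwm i

/-- Near a vector of simple roots of `g` there is a unique stationary solution, for small
coupling. -/
theorem exists_unique_stationary {n : ℕ} [NeZero n] {a d r m : ℝ} {w : ZMod n → ℝ}
    (ha : a ∈ Set.Icc (0 : ℝ) 1) (hw : ∀ i, w i ∈ Set.Icc (0 : ℝ) 1)
    (hg : ∀ i, g a (w i) = 0) (hm : 0 < m) (hwm : ∀ i, m ≤ |gder a (w i)|) (hd : 0 ≤ d)
    (hr0 : 0 < r) (hr : r ≤ 1) (hrm : 36 * r ≤ m) (hdm : 16 * d ≤ r * m) :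
    ∃ u ∈ Metric.ball w r, (∀ i, GF n a d u i = 0) ∧
      ∀ z ∈ Metric.ball w r, (∀ i, GF n a d z i = 0) → z = u := by
  have hne : ∀ i, gder a (w i) ≠ 0 := fun i => abs_pos.1 (hm.trans_le (hwm i))
  have hk : (9 * r + 4 * d) / m ≤ 1 / 2 := by
    rw [div_le_iff₀ hm]; nlinarith
  have hLip : ∀ x ∈ Metric.closedBall w r, ∀ y ∈ Metric.closedBall w r,
      ‖newtonMap n a d w x - newtonMap n a d w y‖ ≤ 1 / 2 * ‖x - y‖ := by
    intro x hx y hy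
    rw [mem_closedBall_iff_norm] at hx hy
    refine (norm_newtonMap_sub_le ha hw hm hwm hd hr hx hy).trans ?_
    gcongr
  have hdisp : ‖newtonMap n a d w w - w‖ ≤ r / 4 := by
    refine (norm_newtonMap_self_sub_le hw hg hm hwm hd).trans ?_
    rw [div_le_iff₀ hm]; linarith
  have hball : ∀ x ∈ Metric.closedBall w r, newtonMap n a d w x ∈ Metric.ball w r := by
    intro x hx
    have h1 := hLip x hx w (Metric.mem_closedBall_self hr0.le)
    rw [mem_closedBall_iff_norm] at hx
    rw [mem_ball_iff_norm]
    have h2 := norm_sub_le_norm_sub_add_norm_sub (newtonMap n a d w x) (newtonMap n a d w w) w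
    linarith
  have hmaps : Set.MapsTo (newtonMap n a d w) (Metric.closedBall w r) (Metric.closedBall w r) :=
    fun x hx => Metric.ball_subset_closedBall (hball x hx)
  have hcontr : ContractingWith (1 / 2) (hmaps.restrict _ _ _) := by
    refine ⟨by norm_num [← NNReal.coe_lt_coe], LipschitzWith.of_dist_le_mul fun x y => ?_⟩
    simpa [Subtype.dist_eq, dist_eq_norm] using hLip x x.2 y y.2
  obtain ⟨u, hu, hfix, -⟩ := hcontr.exists_fixedPoint' Metric.isClosed_closedBall.isComplete hmaps
    (Metric.mem_closedBall_self hr0.le) (edist_ne_top _ _)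
  have hfix' : newtonMap n a d w u = u := hfix
  refine ⟨u, hfix' ▸ hball u hu, (newtonMap_eq_self_iff hne).1 hfix', fun z hz hz0 => ?_⟩
  have h := hLip z (Metric.ball_subset_closedBall hz) u hu
  rw [(newtonMap_eq_self_iff hne).2 hz0, hfix'] at h
  exact sub_eq_zero.1 (norm_eq_zero.1 (by linarith [norm_nonneg (z - u)]))

/-! ### Spectrum of the Jacobian -/

open scoped ComplexOrder in
/-- A Hermitian complex matrix with a diagonal entry of positive real part has an eigenvalue of
positive real part. -/
theorem Matrix.IsHermitian.exists_mem_spectrum_re_pos {ι : Type*} [Fintype ι] [DecidableEq ι]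
    {A : Matrix ι ι ℂ} (hA : A.IsHermitian) {k : ι} (hk : 0 < (A k k).re) :
    ∃ μ ∈ spectrum ℂ A, 0 < μ.re := by
  by_contra! hneg
  have hpsd : (-A).PosSemidef := by
    rw [hA.neg.posSemidef_iff_eigenvalues_nonneg]
    intro j
    have hj : ((hA.neg.eigenvalues j : ℝ) : ℂ) ∈ spectrum ℂ (-A) := by
      rw [hA.neg.spectrum_eq_image_range]
      exact ⟨_, ⟨j, rfl⟩, rfl⟩
    rw [← spectrum.neg_eq, Set.mem_neg] at hj
    simpa using hneg _ hj
  have := (Complex.le_def.1 (hpsd.diag_nonneg (i := k))).1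
  simp at this
  linarith

theorem Jac_isHermitian (n : ℕ) (a d : ℝ) (v : ZMod n → ℝ) :
    ((Jac n a d v).map (Complex.ofReal ·)).IsHermitian := by
  ext i j
  simp only [Matrix.conjTranspose_apply, Matrix.map_apply, RCLike.star_def, Complex.conj_ofReal,
    Jac]
  have h1 : i = j - 1 ↔ j = i + 1 := by rw [eq_sub_iff_add_eq, eq_comm]
  have h2 : i = j + 1 ↔ j = i - 1 := by rw [← sub_eq_iff_eq_add, eq_comm]
  congr 1
  by_cases h : i = j
  · simp [h]
  · simp only [h1, h2, h, Ne.symm h, if_false]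
    ring

theorem Jac_apply_self {n : ℕ} (hn : 2 ≤ n) (a d : ℝ) (v : ZMod n → ℝ) (i : ZMod n) :
    Jac n a d v i i = -(2 * d) + gder a (v i) := by
  have : Fact (1 < n) := ⟨hn⟩
  simp [Jac, eq_sub_iff_add_eq]

/-! ### The gradient structure -/

/-- The antiderivative of `g` vanishing at `0`. -/
noncomputable def gInt (a u : ℝ) : ℝ := -u ^ 4 / 4 + (1 + a) * u ^ 3 / 3 - a * u ^ 2 / 2

theorem hasDerivAt_gInt (a u : ℝ) : HasDerivAt (gInt a) (g a u) u := by
  have h : HasDerivAt (gInt a)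
      (-(((4 : ℕ) : ℝ) * u ^ (4 - 1)) / 4 + (1 + a) * (((3 : ℕ) : ℝ) * u ^ (3 - 1)) / 3
        - a * (((2 : ℕ) : ℝ) * u ^ (2 - 1)) / 2) u :=
    ((((hasDerivAt_pow 4 u).neg.div_const 4)).add
      (((hasDerivAt_pow 3 u).const_mul (1 + a)).div_const 3)).sub
      (((hasDerivAt_pow 2 u).const_mul a).div_const 2)
  convert h using 1
  simp only [g]
  push_cast
  ring

/-- The energy of which `GF` is the negative gradient. -/
noncomputable def energy (n : ℕ) [NeZero n] (a d : ℝ) (v : ZMod n → ℝ) : ℝ :=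
  ∑ i, (d / 2 * (v (i + 1) - v i) ^ 2 - gInt a (v i))

theorem continuous_energy (n : ℕ) [NeZero n] (a d : ℝ) : Continuous (energy n a d) := by
  unfold energy gInt
  fun_prop

/-- Summation by parts on the cycle. -/
theorem sum_diff_mul_diff {n : ℕ} [NeZero n] (v h : ZMod n → ℝ) :
    ∑ i, (v (i + 1) - v i) * (h (i + 1) - h i) =
      -∑ i, (v (i - 1) - 2 * v i + v (i + 1)) * h i := by
  have hshift : ∑ i, (v (i + 1) - v i) * h (i + 1) = ∑ i, (v i - v (i - 1)) * h i := by
    simpa using (Equiv.sum_comp (Equiv.addRight (1 : ZMod n)) fun i => (v i - v (i - 1)) * h i)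
  simp only [mul_sub, Finset.sum_sub_distrib, hshift]
  rw [← Finset.sum_sub_distrib, ← Finset.sum_neg_distrib]
  exact Finset.sum_congr rfl fun i _ => by ring

/-- The energy dissipation identity along solutions. -/
theorem IsODESol.hasDerivAt_energy {n : ℕ} [NeZero n] {a d : ℝ} {V : ℝ → ZMod n → ℝ}
    (hV : IsODESol n a d V) {t : ℝ} (ht : 0 ≤ t) :
    HasDerivAt (fun s => energy n a d (V s)) (-∑ i, GF n a d (V t) i ^ 2) t := by
  have hi := hasDerivAt_pi.1 (hV t ht)
  have h : HasDerivAt (fun s => energy n a d (V s))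
      (∑ i, (d / 2 * (((2 : ℕ) : ℝ) * (V t (i + 1) - V t i) ^ (2 - 1) *
        (GF n a d (V t) (i + 1) - GF n a d (V t) i)) - g a (V t i) * GF n a d (V t) i)) t :=
    HasDerivAt.fun_sum fun i _ =>
      ((((hi (i + 1)).sub (hi i)).pow 2).const_mul (d / 2)).sub
        (HasDerivAt.comp (h₂ := gInt a) t (hasDerivAt_gInt a (V t i)) (hi i))
  convert h using 1
  have hparts := sum_diff_mul_diff (V t) (GF n a d (V t))
  have hsplit : ∀ i, d / 2 * (((2 : ℕ) : ℝ) * (V t (i + 1) - V t i) ^ (2 - 1) *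
        (GF n a d (V t) (i + 1) - GF n a d (V t) i)) - g a (V t i) * GF n a d (V t) i =
      d * ((V t (i + 1) - V t i) * (GF n a d (V t) (i + 1) - GF n a d (V t) i))
        - g a (V t i) * GF n a d (V t) i := fun i => by push_cast; ring
  rw [Finset.sum_congr rfl fun i _ => hsplit i, Finset.sum_sub_distrib, ← Finset.mul_sum, hparts,
    mul_neg, Finset.mul_sum, ← neg_add', ← Finset.sum_add_distrib]
  congr 1
  refine Finset.sum_congr rfl fun i _ => ?_
  simp only [GF]
  ring

/-- The energy does not increase along solutions. -/
theorem IsODESol.energy_le {n : ℕ} [NeZero n] {a d : ℝ} {V : ℝ → ZMod n → ℝ}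
    (hV : IsODESol n a d V) {t : ℝ} (ht : 0 ≤ t) :
    energy n a d (V t) ≤ energy n a d (V 0) := by
  have hanti : AntitoneOn (fun s => energy n a d (V s)) (Set.Ici 0) := by
    refine antitoneOn_of_hasDerivWithinAt_nonpos (convex_Ici 0)
      (fun s hs => (hV.hasDerivAt_energy hs).continuousAt.continuousWithinAt)
      (fun s hs => (hV.hasDerivAt_energy (interior_subset hs)).hasDerivWithinAt)
      fun s _ => ?_
    exact neg_nonpos.2 (Finset.sum_nonneg fun i _ => sq_nonneg _)
  exact hanti Set.self_mem_Ici ht ht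

/-- A solution starting at an energy below that of `p` does not converge to `p`. -/
theorem IsODESol.not_tendsto_of_energy_lt {n : ℕ} [NeZero n] {a d : ℝ} {V : ℝ → ZMod n → ℝ}
    (hV : IsODESol n a d V) {p : ZMod n → ℝ} (hp : energy n a d (V 0) < energy n a d p) :
    ¬ Tendsto V atTop (nhds p) := by
  intro hlim
  refine hp.not_ge (le_of_tendsto (((continuous_energy n a d).tendsto p).comp hlim) ?_)
  filter_upwards [eventually_ge_atTop 0] with t ht
  exact hV.energy_le ht

/-- Perturbing a stationary solution at one site where the derivative of `g` dominates the coupling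
lowers the energy. -/
theorem energy_add_single_lt {n : ℕ} [NeZero n] {a d s : ℝ} {u : ZMod n → ℝ} (hd : 0 ≤ d)
    (hu : ∀ i, GF n a d u i = 0) {k : ZMod n} (hs : s ≠ 0)
    (hk : 2 * d < gder a (u k) / 2 + (1 + a - 3 * u k) / 3 * s - s ^ 2 / 4) :
    energy n a d (u + Pi.single k s) < energy n a d u := by
  set h : ZMod n → ℝ := Pi.single k s with hh
  have hparts := sum_diff_mul_diff u h
  have hdiff : energy n a d (u + h) - energy n a d u =
      ∑ i, d / 2 * (h (i + 1) - h i) ^ 2 -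
        ∑ i, (gInt a (u i + h i) - gInt a (u i) - g a (u i) * h i) := by
    have hlap : d * ∑ i, (u (i + 1) - u i) * (h (i + 1) - h i) = ∑ i, g a (u i) * h i := by
      rw [hparts, mul_neg, Finset.mul_sum, ← Finset.sum_neg_distrib]
      refine Finset.sum_congr rfl fun i _ => ?_
      have := hu i
      simp only [GF] at this
      linear_combination -h i * this
    simp only [energy, Pi.add_apply]
    rw [Finset.sum_sub_distrib (f := fun i => gInt a (u i + h i) - gInt a (u i)), ← hlap,
      Finset.mul_sum, ← Finset.sum_sub_distrib, ← Finset.sum_sub_distrib,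
      ← Finset.sum_sub_distrib]
    exact Finset.sum_congr rfl fun i _ => by ring
  have hsq : ∑ i, h i ^ 2 = s ^ 2 := by
    rw [Finset.sum_eq_single k (fun i _ hi => by simp [hh, hi]) (by simp)]
    simp [hh]
  have hshift : ∑ i, h (i + 1) ^ 2 = s ^ 2 := by
    rw [← hsq]
    exact Equiv.sum_comp (Equiv.addRight (1 : ZMod n)) fun i => h i ^ 2
  have hcoup : ∑ i, d / 2 * (h (i + 1) - h i) ^ 2 ≤ 2 * d * s ^ 2 := by
    calc ∑ i, d / 2 * (h (i + 1) - h i) ^ 2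
        ≤ ∑ i, (d * h (i + 1) ^ 2 + d * h i ^ 2) :=
          Finset.sum_le_sum fun i _ => by nlinarith [mul_nonneg hd (sq_nonneg (h (i + 1) + h i))]
      _ = 2 * d * s ^ 2 := by
          rw [Finset.sum_add_distrib, ← Finset.mul_sum, ← Finset.mul_sum, hsq, hshift]; ring
  have hpot : ∑ i, (gInt a (u i + h i) - gInt a (u i) - g a (u i) * h i) =
      s ^ 2 * (gder a (u k) / 2 + (1 + a - 3 * u k) / 3 * s - s ^ 2 / 4) := by
    rw [Finset.sum_eq_single k (fun i _ hi => by simp [hh, hi]) (by simp)]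
    simp only [hh, Pi.single_eq_same, gInt, g, gder]
    ring
  have := mul_lt_mul_of_pos_left hk (sq_pos_of_ne_zero hs)
  linarith

/-! ### Global forward solutions -/

/-- Truncation of every coordinate to `[-2, 2]`. -/
noncomputable def truncate {n : ℕ} (v : ZMod n → ℝ) : ZMod n → ℝ := fun i => max (-2) (min 2 (v i))

theorem truncate_mem {n : ℕ} (v : ZMod n → ℝ) (i : ZMod n) :
    truncate v i ∈ Set.Icc (-2 : ℝ) 2 :=
  ⟨le_max_left _ _, max_le (by norm_num) (min_le_left _ _)⟩

theorem truncate_eq_self {n : ℕ} {v : ZMod n → ℝ} (hv : ∀ i, v i ∈ Set.Icc (-2 : ℝ) 2) :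
    truncate v = v :=
  funext fun i => by rw [truncate, min_eq_right (hv i).2, max_eq_right (hv i).1]

theorem norm_truncate_le {n : ℕ} [NeZero n] (v : ZMod n → ℝ) : ‖truncate v‖ ≤ 2 :=
  (pi_norm_le_iff_of_nonneg zero_le_two).2 fun i => abs_le.2 (truncate_mem v i)

theorem norm_truncate_sub_le {n : ℕ} [NeZero n] (v z : ZMod n → ℝ) :
    ‖truncate v - truncate z‖ ≤ ‖v - z‖ := by
  refine (pi_norm_le_iff_of_nonneg (norm_nonneg _)).2 fun i => ?_
  refine le_trans ?_ (norm_le_pi_norm (v - z) i)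
  simp only [Pi.sub_apply, truncate, Real.norm_eq_abs]
  refine (abs_max_sub_max_le_max _ _ _ _).trans (max_le (by simp) ?_)
  exact (abs_min_sub_min_le_max _ _ _ _).trans (max_le (by simp) le_rfl)

/-- The truncated vector field is globally Lipschitz. -/
theorem norm_GF_truncate_sub_le {n : ℕ} [NeZero n] {a d : ℝ} (ha : a ∈ Set.Icc (0 : ℝ) 1)
    (hd : 0 ≤ d) (v z : ZMod n → ℝ) :
    ‖GF n a d (truncate v) - GF n a d (truncate z)‖ ≤ (4 * d + 21) * ‖v - z‖ := by
  refine le_trans ?_ (mul_le_mul_of_nonneg_left (norm_truncate_sub_le v z) (by positivity))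
  obtain ⟨ha0, ha1⟩ := ha
  set x := truncate v
  set y := truncate z
  refine (pi_norm_le_iff_of_nonneg (by positivity)).2 fun i => ?_
  have heq : (GF n a d x - GF n a d y) i =
      d * ((x - y) (i - 1) - 2 * (x - y) i + (x - y) (i + 1)) +
        (-(x i ^ 2 + x i * y i + y i ^ 2) + (1 + a) * (x i + y i) - a) * (x - y) i := by
    simp only [GF, g, Pi.sub_apply]; ring
  have hq : |-(x i ^ 2 + x i * y i + y i ^ 2) + (1 + a) * (x i + y i) - a| ≤ 21 := by
    obtain ⟨hx1, hx2⟩ : x i ∈ Set.Icc (-2 : ℝ) 2 := truncate_mem v i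
    obtain ⟨hy1, hy2⟩ : y i ∈ Set.Icc (-2 : ℝ) 2 := truncate_mem z i
    rw [abs_le]
    constructor <;> nlinarith
  rw [heq, add_mul (4 * d), Real.norm_eq_abs]
  refine (abs_add_le _ _).trans (add_le_add ?_ ?_)
  · rw [abs_mul, abs_of_nonneg hd]
    linarith [mul_le_mul_of_nonneg_left (abs_laplacian_le (x - y) i) hd]
  · rw [abs_mul]
    exact mul_le_mul hq (norm_le_pi_norm (x - y) i) (abs_nonneg _) (by norm_num)

/-- The truncated vector field is bounded. -/
theorem norm_GF_truncate_le {n : ℕ} [NeZero n] {a d : ℝ} (ha : a ∈ Set.Icc (0 : ℝ) 1)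
    (hd : 0 ≤ d) (v : ZMod n → ℝ) :
    ‖GF n a d (truncate v)‖ ≤ (4 * d + 21) * 2 := by
  have h := norm_GF_truncate_sub_le ha hd (truncate v) (0 : ZMod n → ℝ)
  have h0 : GF n a d (truncate (0 : ZMod n → ℝ)) = 0 := by
    rw [truncate_eq_self (by simp)]
    funext i
    simp [GF, g]
  rw [truncate_eq_self (truncate_mem v), h0, sub_zero, sub_zero] at h
  exact h.trans (mul_le_mul_of_nonneg_left (norm_truncate_le v) (by positivity))

/-- A differentiable function whose derivative is negative at level `c` stays below `c`. -/
theorem le_const_of_deriv_neg {f f' : ℝ → ℝ} {c : ℝ} (hf : ∀ t, HasDerivAt f (f' t) t)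
    (h0 : f 0 ≤ c) (hc : ∀ t, f t = c → f' t < 0) {t : ℝ} (ht : 0 ≤ t) : f t ≤ c :=
  image_le_of_deriv_right_lt_deriv_boundary (B := fun _ => c) (B' := fun _ => 0)
    (fun s _ => (hf s).continuousAt.continuousWithinAt) (fun s _ => (hf s).hasDerivWithinAt) h0
    (fun s => hasDerivAt_const s c) (fun s _ => hc s) (Set.right_mem_Icc.2 ht)

/-- Forward solutions starting in the box `[-2, 2]ⁿ` exist for all times. -/
theorem exists_isODESol {n : ℕ} [NeZero n] {a d : ℝ} (ha : a ∈ Set.Icc (0 : ℝ) 1) (hd : 0 ≤ d)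
    {x : ZMod n → ℝ} (hx : ∀ i, x i ∈ Set.Icc (-2 : ℝ) 2) :
    ∃ V : ℝ → ZMod n → ℝ, V 0 = x ∧ IsODESol n a d V := by
  obtain ⟨V, hV0, hV⟩ := exists_global_solution_of_lipschitzWith_of_bounded
    (f := fun v => GF n a d (truncate v)) (K := ⟨4 * d + 21, by positivity⟩)
    (L := ⟨(4 * d + 21) * 2, by positivity⟩)
    (LipschitzWith.of_dist_le_mul fun v z => by
      rw [dist_eq_norm, dist_eq_norm]; exact norm_GF_truncate_sub_le ha hd v z)
    (fun v => norm_GF_truncate_le ha hd v) x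
  refine ⟨V, hV0, fun t ht => ?_⟩
  have hVi := fun s => hasDerivAt_pi.1 (hV s)
  obtain ⟨ha0, ha1⟩ := ha
  have hbox : ∀ i, V t i ∈ Set.Icc (-2 : ℝ) 2 := by
    intro i
    constructor
    · have := le_const_of_deriv_neg (f := fun s => -V s i) (c := 2) (fun s => (hVi s i).neg)
        (by rw [hV0]; linarith [(hx i).1]) (fun s hs => ?_) ht
      · linarith
      · have hi : truncate (V s) i = -2 := by
          rw [truncate, show V s i = -2 by linarith]; norm_num
        simp only [GF, hi, g]
        nlinarith [mul_nonneg hd (by linarith [(truncate_mem (V s) (i - 1)).1,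
          (truncate_mem (V s) (i + 1)).1] :
          0 ≤ truncate (V s) (i - 1) - 2 * -2 + truncate (V s) (i + 1))]
    · refine le_const_of_deriv_neg (f := fun s => V s i) (c := 2) (fun s => hVi s i)
        (by rw [hV0]; exact (hx i).2) (fun s hs => ?_) ht
      have hi : truncate (V s) i = 2 := by
        rw [truncate, hs]; norm_num
      simp only [GF, hi, g]
      nlinarith [mul_nonneg hd (by linarith [(truncate_mem (V s) (i - 1)).2,
        (truncate_mem (V s) (i + 1)).2] :
        0 ≤ -(truncate (V s) (i - 1) - 2 * 2 + truncate (V s) (i + 1)))]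
  simpa only [truncate_eq_self hbox] using hV t

/-- A stationary solution with a site at which the derivative of `g` dominates the coupling is not
asymptotically stable. -/
theorem not_odeAsympStable_of_lt_gder {n : ℕ} [NeZero n] {a d : ℝ} (ha : a ∈ Set.Icc (0 : ℝ) 1)
    (hd : 0 ≤ d) {u : ZMod n → ℝ} (hu : ∀ i, GF n a d u i = 0)
    (hbox : ∀ i, u i ∈ Set.Ioo (-2 : ℝ) 2) {k : ZMod n} (hk : 4 * d < gder a (u k)) :
    ¬ ODEAsympStable n a d u := by
  rintro ⟨-, δ, hδ, hconv⟩
  have hev : ∀ᶠ s in nhdsWithin (0 : ℝ) {0}ᶜ, s ≠ 0 ∧ |s| < δ ∧ u k + s ∈ Set.Ioo (-2 : ℝ) 2 ∧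
      2 * d < gder a (u k) / 2 + (1 + a - 3 * u k) / 3 * s - s ^ 2 / 4 := by
    refine eventually_mem_nhdsWithin.and (Eventually.filter_mono nhdsWithin_le_nhds ?_)
    refine Eventually.and ?_ (Eventually.and ?_ ?_)
    · exact (continuous_abs.tendsto' 0 0 abs_zero).eventually (gt_mem_nhds hδ)
    · exact ((continuous_const.add continuous_id).tendsto' 0 (u k) (by simp)).eventually
        (Ioo_mem_nhds (hbox k).1 (hbox k).2)
    · refine (Continuous.tendsto' (by fun_prop) 0 (gder a (u k) / 2) (by simp)).eventually
        (lt_mem_nhds (by linarith))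
  obtain ⟨s, hs, hsδ, hsbox, hsE⟩ := hev.exists
  obtain ⟨V, hV0, hV⟩ := exists_isODESol (n := n) (x := u + Pi.single k s) ha hd fun i => by
    by_cases hi : i = k
    · subst hi; simpa using Set.Ioo_subset_Icc_self hsbox
    · simpa [hi] using Set.Ioo_subset_Icc_self (hbox i)
  refine hV.not_tendsto_of_energy_lt (p := u) ?_ (hconv V hV ?_)
  · rw [hV0]; exact energy_add_single_lt hd hu hs hsE
  · rw [hV0, add_sub_cancel_left, Pi.norm_single]; exact hsδ

/-- For every word `w ∈ {0,a,1}ⁿ` containing at least one entry equal to `a` and all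
small `d > 0`, there is a unique stationary solution of the cyclic Nagumo system near
`w`; its Jacobian has an eigenvalue with positive real part and it is not an
asymptotically stable equilibrium of the graph Nagumo ODE. -/
theorem unstable_branch_of_root_with_a_entry
    (n : ℕ) [NeZero n] (hn : 3 ≤ n) (a : ℝ) (ha : a ∈ Set.Ioo (0:ℝ) 1)
    (w : ZMod n → ℝ) (hw : ∀ i, w i = 0 ∨ w i = a ∨ w i = 1) (hwa : ∃ i, w i = a) :
    ∃ d0 > (0:ℝ), ∃ ε > (0:ℝ), ∀ d ∈ Set.Ioo (0:ℝ) d0,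
      ∃ uw : ZMod n → ℝ,
        (uw ∈ Metric.ball w ε ∧ ∀ i : ZMod n, GF n a d uw i = 0) ∧
        (∀ z : ZMod n → ℝ,
          (z ∈ Metric.ball w ε ∧ ∀ i : ZMod n, GF n a d z i = 0) → z = uw) ∧
        (∃ μ ∈ spectrum ℂ ((Jac n a d uw).map (Complex.ofReal ·)), 0 < μ.re) ∧
        ¬ ODEAsympStable n a d uw := by
  obtain ⟨ha0, ha1⟩ := ha
  obtain ⟨k, hk⟩ := hwa
  have ha' : a ∈ Set.Icc (0 : ℝ) 1 := ⟨ha0.le, ha1.le⟩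
  have hw01 : ∀ i, w i ∈ Set.Icc (0 : ℝ) 1 := fun i => by
    rcases hw i with h | h | h <;> rw [h]
    exacts [⟨le_rfl, zero_le_one⟩, ha', ⟨zero_le_one, le_rfl⟩]
  obtain ⟨m, hm⟩ : ∃ m, m = a * (1 - a) := ⟨_, rfl⟩
  have hm0 : 0 < m := hm ▸ mul_pos ha0 (sub_pos.2 ha1)
  have hm1 : m ≤ 1 := by nlinarith
  have hwm : ∀ i, m ≤ |gder a (w i)| := fun i => hm ▸ le_abs_gder_of_root ⟨ha0, ha1⟩ (hw i)
  refine ⟨m / 36 * m / 16, by positivity, m / 36, by positivity, fun d ⟨hd0, hd⟩ => ?_⟩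
  obtain ⟨u, hub, hu, huniq⟩ := exists_unique_stationary (d := d) (r := m / 36) ha' hw01
    (fun i => g_eq_zero_of_root (hw i)) hm0 hwm hd0.le (by positivity) (by linarith)
    (by linarith) (by linarith)
  have hui : ∀ i, |u i - w i| < m / 36 := fun i =>
    (norm_le_pi_norm (u - w) i).trans_lt (mem_ball_iff_norm.1 hub)
  have hder : 4 * d < gder a (u k) := by
    have h1 := (abs_le.1 (abs_gder_sub_gder_le ha' (hw01 k) (by linarith) (hui k).le)).1
    have h2 : gder a (w k) = m := by rw [hk, hm]; simp only [gder]; ring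
    nlinarith
  have hbox : ∀ i, u i ∈ Set.Ioo (-2 : ℝ) 2 := fun i => by
    have h := abs_lt.1 (hui i)
    constructor <;> linarith [h.1, h.2, (hw01 i).1, (hw01 i).2]
  refine ⟨u, ⟨hub, hu⟩, fun z hz => huniq z hz.1 hz.2, ?_,
    not_odeAsympStable_of_lt_gder ha' hd0.le hu hbox hder⟩
  refine (Jac_isHermitian n a d u).exists_mem_spectrum_re_pos (k := k) ?_
  rw [Matrix.map_apply, Complex.ofReal_re, Jac_apply_self (by omega)]
  linarith
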